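/- For fixed symmetric complex n×n matrix Ω with positive definite imaginary part and fixed Z ∈ ℂ^{m×n}, the Gaussian integral ∫_{ℝ^{m×n}} exp(πi·tr(xΩ·ᵗx + 2x·ᵗZ)) dx equals (det(Ω/i))^{-m/2} · exp(-πi·tr(Z·Ω^{-1}·ᵗZ)), where the square root of the determinant is the branch that is positive on positive definite real matrices. -/

import Mathlib

open Matrix MeasureTheory Complex

noncomputable section

/-- Cast a real matrix to a complex matrix entrywise. -/
def mc {k l : ℕ} (A : Matrix (Fin k) (Fin l) ℝ) : Matrix (Fin k) (Fin l) ℂ :=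
  A.map Complex.ofReal

/-- The Siegel upper half plane: symmetric with positive definite imaginary part. -/
def InSiegel {n : ℕ} (Ω : Matrix (Fin n) (Fin n) ℂ) : Prop :=
  Ω.IsSymm ∧ (Ω.map Complex.im).PosDef

/-- Symmetric complex matrices with positive definite real part. -/
def InS {n : ℕ} (S : Matrix (Fin n) (Fin n) ℂ) : Prop :=
  S.IsSymm ∧ (S.map Complex.re).PosDef

open scoped Real

namespace Matrix

lemma PosDef.exists_eq_transpose_mul_self {ι : Type*} [Fintype ι] [DecidableEq ι]
    {A : Matrix ι ι ℝ} (hA : A.PosDef) : ∃ C : Matrix ι ι ℝ, C.det ≠ 0 ∧ A = Cᵀ * C := by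
  open scoped MatrixOrder Matrix.Norms.L2Operator in
  obtain ⟨y, hy, h⟩ := CStarAlgebra.isStrictlyPositive_iff_eq_star_mul_self.mp
    hA.isStrictlyPositive
  exact ⟨y, ((isUnit_iff_isUnit_det _).1 hy).ne_zero, by
    rw [h, star_eq_conjTranspose, conjTranspose_eq_transpose_of_trivial]⟩

/-- Simultaneous diagonalization of a positive definite and a symmetric real quadratic form. -/
lemma PosDef.exists_simultaneous_diagonalization {ι : Type*} [Fintype ι] [DecidableEq ι]
    {A B : Matrix ι ι ℝ} (hA : A.PosDef) (hB : B.IsSymm) :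
    ∃ (Q : Matrix ι ι ℝ) (d : ι → ℝ),
      Q.det ≠ 0 ∧ A = Qᵀ * Q ∧ B = Qᵀ * diagonal d * Q := by
  obtain ⟨C, hC, rfl⟩ := hA.exists_eq_transpose_mul_self
  have hCu : IsUnit C.det := hC.isUnit
  have hCtu : IsUnit Cᵀ.det := by rwa [det_transpose]
  set E := (C⁻¹)ᵀ * B * C⁻¹ with hE
  have hEs : E.IsHermitian := by
    rw [IsHermitian, conjTranspose_eq_transpose_of_trivial, hE]
    simp only [transpose_mul, transpose_transpose, hB.eq, Matrix.mul_assoc]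
  have hBE : B = Cᵀ * E * C := by
    rw [hE, transpose_nonsing_inv]
    simp only [← Matrix.mul_assoc]
    rw [mul_nonsing_inv _ hCtu, Matrix.one_mul, Matrix.mul_assoc, nonsing_inv_mul _ hCu,
      Matrix.mul_one]
  have hspec := hEs.spectral_theorem
  set U : Matrix ι ι ℝ := (hEs.eigenvectorUnitary : Matrix ι ι ℝ)
  have hUU : U * Uᵀ = 1 := by
    have := Unitary.coe_mul_star_self hEs.eigenvectorUnitary
    rwa [Unitary.coe_star, star_eq_conjTranspose, conjTranspose_eq_transpose_of_trivial] at this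
  refine ⟨Uᵀ * C, hEs.eigenvalues, ?_, ?_, ?_⟩
  · have h1 : U.det * Uᵀ.det = 1 := by rw [← det_mul, hUU, det_one]
    rw [det_mul]
    exact mul_ne_zero (right_ne_zero_of_mul_eq_one h1) hC
  · rw [transpose_mul, transpose_transpose, Matrix.mul_assoc, ← Matrix.mul_assoc U, hUU,
      Matrix.one_mul]
  · have hE' : E = U * diagonal hEs.eigenvalues * Uᵀ := by
      rw [Unitary.conjStarAlgAut_apply, star_eq_conjTranspose,
        conjTranspose_eq_transpose_of_trivial] at hspec
      exact hspec
    rw [transpose_mul, transpose_transpose]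
    conv_lhs => rw [hBE, hE']
    simp only [Matrix.mul_assoc]

end Matrix

lemma mc_mul {k l p : ℕ} (A : Matrix (Fin k) (Fin l) ℝ) (B : Matrix (Fin l) (Fin p) ℝ) :
    mc (A * B) = mc A * mc B :=
  Matrix.map_mul (f := Complex.ofRealHom)

lemma det_mc {k : ℕ} (A : Matrix (Fin k) (Fin k) ℝ) : (mc A).det = A.det :=
  (RingHom.map_det Complex.ofRealHom A).symm

lemma mc_transpose {k l : ℕ} (A : Matrix (Fin k) (Fin l) ℝ) : mc Aᵀ = (mc A)ᵀ := rfl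

lemma mc_diagonal {k : ℕ} (d : Fin k → ℝ) : mc (diagonal d) = diagonal fun j => (d j : ℂ) := by
  rw [mc, diagonal_map (by simp)]

lemma mc_mulVec {k l : ℕ} (A : Matrix (Fin k) (Fin l) ℝ) (v : Fin l → ℝ) (i : Fin k) :
    (mc A *ᵥ fun j => (v j : ℂ)) i = ((A *ᵥ v) i : ℝ) := by
  simp [mc, mulVec, dotProduct]

lemma mc_add_smul_eq {n : ℕ} (Q : Matrix (Fin n) (Fin n) ℝ) (d : Fin n → ℝ) (z : ℂ) :
    mc (Qᵀ * Q) + z • mc (Qᵀ * diagonal d * Q)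
      = (mc Q)ᵀ * diagonal (fun j => 1 + z * (d j : ℂ)) * mc Q := by
  have h : diagonal (fun j => 1 + z * (d j : ℂ))
      = 1 + z • diagonal (fun j => (d j : ℂ)) := by
    rw [← diagonal_one, ← diagonal_smul, diagonal_add]; rfl
  rw [h, mc_mul, mc_mul, mc_mul, mc_transpose, mc_diagonal]
  simp [Matrix.mul_add, Matrix.add_mul]

/-- The continuous branch of the square root of the determinant in diagonalizing coordinates. -/
lemma sqrt_det_branch_eq {n : ℕ} (sqD : Matrix (Fin n) (Fin n) ℂ → ℂ)
    (hcont : ContinuousOn sqD {S | InS S})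
    (hsq : ∀ S, InS S → (sqD S) ^ 2 = S.det)
    (hposval : ∀ S : Matrix (Fin n) (Fin n) ℝ, S.PosDef → sqD (mc S) = Real.sqrt S.det)
    (Q : Matrix (Fin n) (Fin n) ℝ) (d : Fin n → ℝ) (hQ : Q.det ≠ 0)
    (hA : (Qᵀ * Q).PosDef) :
    sqD ((mc Q)ᵀ * diagonal (fun j => 1 + I * (d j : ℂ)) * mc Q)
      = |Q.det| * ∏ j, (1 + I * (d j : ℂ)) ^ (1 / 2 : ℂ) := by
  set S : ℝ → Matrix (Fin n) (Fin n) ℂ := fun t =>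
    mc (Qᵀ * Q) + (t * I : ℂ) • mc (Qᵀ * diagonal d * Q) with hS
  have hS' : ∀ t, S t = (mc Q)ᵀ * diagonal (fun j => 1 + (t * I) * (d j : ℂ)) * mc Q :=
    fun t => mc_add_smul_eq Q d _
  have hSmem : ∀ t, InS (S t) := by
    intro t
    constructor
    · rw [hS', IsSymm]
      simp [Matrix.transpose_mul, Matrix.mul_assoc]
    · convert! hA using 1
      ext i j
      simp [hS, mc]
  have hre : ∀ (t : ℝ) j, 0 < (1 + (t * I) * (d j : ℂ)).re := by
    intro t j; simp
  have hne : ∀ (t : ℝ) j, (1 + (t * I) * (d j : ℂ)) ≠ 0 := by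
    intro t j h
    simpa [h] using hre t j
  have hScont : Continuous S := by fun_prop
  have key := isPreconnected_univ.eq_of_sq_eq (f := fun t : ℝ => sqD (S t))
    (g := fun t : ℝ => ((|Q.det| : ℝ) : ℂ) * ∏ j, (1 + (t * I) * (d j : ℂ)) ^ (1 / 2 : ℂ))
    (S := Set.univ) (y := 0)
    (hcont.comp hScont.continuousOn fun t _ => hSmem t)
    (Continuous.continuousOn <| continuous_const.mul <| continuous_finsetProd _ fun j _ =>
      continuous_iff_continuousAt.2 fun t =>
        ContinuousAt.cpow (by fun_prop) continuousAt_const (Or.inl (hre t j)))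
    (by
      intro t _
      have h2 : ∀ j, ((1 + (t * I) * (d j : ℂ)) ^ (1 / 2 : ℂ)) ^ 2
          = 1 + (t * I) * (d j : ℂ) := by
        intro j
        rw [← cpow_nat_mul]
        simp
      simp only [Pi.pow_apply]
      rw [hsq _ (hSmem t), hS', det_mul, det_mul, det_transpose, det_diagonal, det_mc,
        mul_pow, ← Finset.prod_pow, Finset.prod_congr rfl fun j _ => h2 j, ← ofReal_pow, sq_abs,
        ofReal_pow]
      ring)
    (by
      intro t _
      refine mul_ne_zero (by simpa using hQ) (Finset.prod_ne_zero_iff.2 fun j _ => ?_)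
      rw [Ne, cpow_eq_zero_iff]
      exact fun h => hne t j h.1)
    (Set.mem_univ _)
    (by
      have : S 0 = mc (Qᵀ * Q) := by simp [hS]
      simp only [this]
      rw [hposval _ hA, det_mul, det_transpose, Real.sqrt_mul_self_eq_abs]
      simp)
  have h1 := key (Set.mem_univ (1 : ℝ))
  simp only [hS', ofReal_one, one_mul] at h1
  exact h1

lemma measurableEmbedding_toLin' {n : ℕ} {Q : Matrix (Fin n) (Fin n) ℝ} (hQ : Q.det ≠ 0) :
    MeasurableEmbedding (toLin' Q) := by
  have h : LinearMap.det (toLin' Q) ≠ 0 := by rwa [LinearMap.det_toLin']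
  have := (LinearEquiv.toContinuousLinearEquiv
    (LinearMap.equivOfDetNeZero (toLin' Q) h)).toHomeomorph.measurableEmbedding
  exact this

lemma exp_quadratic_eq_comp {n : ℕ} {Q : Matrix (Fin n) (Fin n) ℝ} (hQ : Q.det ≠ 0)
    (b z : Fin n → ℂ) (v : Fin n → ℝ) :
    cexp (-π * ((fun j => (v j : ℂ)) ⬝ᵥ
        ((mc Q)ᵀ * diagonal b * mc Q) *ᵥ fun j => (v j : ℂ))
      + 2 * π * I * ((fun j => (v j : ℂ)) ⬝ᵥ z))
    = cexp (-∑ j, (π * b j) * (toLin' Q v j : ℂ) ^ 2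
      + ∑ j, (2 * π * I * (((mc Q)ᵀ)⁻¹ *ᵥ z) j) * (toLin' Q v j : ℂ)) := by
  have hu : IsUnit (mc Q)ᵀ.det := by
    rw [det_transpose, det_mc]
    exact (ofReal_ne_zero.2 hQ).isUnit
  have hz : z = (mc Q)ᵀ *ᵥ (((mc Q)ᵀ)⁻¹ *ᵥ z) := by
    rw [mulVec_mulVec, mul_nonsing_inv _ hu, one_mulVec]
  set c := ((mc Q)ᵀ)⁻¹ *ᵥ z
  have hT : ∀ w : Fin n → ℂ, (fun j => (v j : ℂ)) ⬝ᵥ (mc Q)ᵀ *ᵥ w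
      = ∑ j, (toLin' Q v j : ℂ) * w j := by
    intro w
    rw [dotProduct_mulVec, vecMul_transpose, dotProduct]
    simp only [mc_mulVec, toLin'_apply]
  rw [hz, Matrix.mul_assoc, ← mulVec_mulVec, hT, hT, ← mulVec_mulVec]
  simp only [mulVec_diagonal, mc_mulVec, toLin'_apply, Finset.mul_sum, ← Finset.sum_neg_distrib]
  congr 2 <;> exact Finset.sum_congr rfl fun j _ => by ring

lemma integral_cexp_quadratic_form {n : ℕ} {Q : Matrix (Fin n) (Fin n) ℝ} (hQ : Q.det ≠ 0)
    (b z : Fin n → ℂ) (hb : ∀ j, 0 < (b j).re) :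
    Integrable (fun v : Fin n → ℝ => cexp (-π * ((fun j => (v j : ℂ)) ⬝ᵥ
        ((mc Q)ᵀ * diagonal b * mc Q) *ᵥ fun j => (v j : ℂ))
      + 2 * π * I * ((fun j => (v j : ℂ)) ⬝ᵥ z))) ∧
    ∫ v : Fin n → ℝ, cexp (-π * ((fun j => (v j : ℂ)) ⬝ᵥ
        ((mc Q)ᵀ * diagonal b * mc Q) *ᵥ fun j => (v j : ℂ))
      + 2 * π * I * ((fun j => (v j : ℂ)) ⬝ᵥ z))
    = (|Q.det| * ∏ j, (b j) ^ (1 / 2 : ℂ))⁻¹ *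
      cexp (-π * (z ⬝ᵥ ((mc Q)ᵀ * diagonal b * mc Q)⁻¹ *ᵥ z)) := by
  have hπb : ∀ j, 0 < ((π : ℂ) * b j).re := fun j => by
    simpa using mul_pos Real.pi_pos (hb j)
  have hbne : ∀ j, b j ≠ 0 := fun j h => by simpa [h] using hb j
  have hemb := measurableEmbedding_toLin' hQ
  have hmap := Real.map_matrix_volume_pi_eq_smul_volume_pi hQ
  simp only [exp_quadratic_eq_comp hQ]
  set c := ((mc Q)ᵀ)⁻¹ *ᵥ z with hc
  set G : (Fin n → ℝ) → ℂ := fun y =>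
    cexp (-∑ j, (π * b j) * (y j : ℂ) ^ 2 + ∑ j, (2 * π * I * c j) * (y j : ℂ)) with hG
  have hGint : Integrable G := GaussianFourier.integrable_cexp_neg_sum_mul_add hπb _
  have hGval := GaussianFourier.integral_cexp_neg_sum_mul_add hπb (fun j => 2 * π * I * c j)
  constructor
  · have : Integrable (G ∘ toLin' Q) := by
      rw [← hemb.integrable_map_iff, hmap]
      exact hGint.smul_measure ENNReal.ofReal_ne_top
    exact this
  · have h1 : ∫ v : Fin n → ℝ, G (toLin' Q v) = |Q.det|⁻¹ * ∫ y, G y := by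
      rw [← hemb.integral_map, hmap, integral_smul_measure, ENNReal.toReal_ofReal (abs_nonneg _),
        abs_inv, real_smul, ofReal_inv]
    refine h1.trans ?_
    rw [hG, hGval, mul_inv, Finset.prod_mul_distrib, ← mul_assoc]
    congr 1
    · rw [ofReal_inv, ← Finset.prod_inv_distrib]
      congr 1
      refine Finset.prod_congr rfl fun j _ => ?_
      have harg : (b j).arg ≠ π := fun h => by
        have := (arg_eq_pi_iff.1 h).1
        exact absurd (hb j) this.not_gt
      rw [← inv_cpow _ _ harg]
      congr 1
      have := hbne j
      field_simp
    · have hdiag : (diagonal b)⁻¹ = diagonal fun j => (b j)⁻¹ := by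
        refine inv_eq_right_inv ?_
        rw [diagonal_mul_diagonal, ← diagonal_one]
        congr 1
        funext j
        exact mul_inv_cancel₀ (hbne j)
      rw [← Complex.exp_sum, Matrix.mul_inv_rev, Matrix.mul_inv_rev, hdiag, ← mulVec_mulVec,
        dotProduct_mulVec, ← mulVec_transpose, transpose_nonsing_inv, ← mulVec_mulVec, ← hc,
        dotProduct, Finset.mul_sum]
      congr 1
      refine Finset.sum_congr rfl fun j _ => ?_
      rw [mulVec_diagonal]
      have := hbne j
      field_simp
      rw [I_sq]
      ring

lemma InSiegel.exists_diagonalization {n : ℕ} {Ω : Matrix (Fin n) (Fin n) ℂ} (hΩ : InSiegel Ω) :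
    ∃ (Q : Matrix (Fin n) (Fin n) ℝ) (d : Fin n → ℝ), Q.det ≠ 0 ∧ (Qᵀ * Q).PosDef ∧
      (-I) • Ω = (mc Q)ᵀ * diagonal (fun j => 1 + I * (d j : ℂ)) * mc Q := by
  have hB : (-Ω.map re).IsSymm := by
    rw [IsSymm, transpose_neg, ← transpose_map, hΩ.1.eq]
  obtain ⟨Q, d, hQ, hA, hB⟩ := hΩ.2.exists_simultaneous_diagonalization hB
  refine ⟨Q, d, hQ, hA ▸ hΩ.2, ?_⟩
  rw [← mc_add_smul_eq, ← hA, ← hB]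
  ext i j
  apply Complex.ext <;> simp [mc]

lemma exp_trace_eq_prod {n m : ℕ} (Ω : Matrix (Fin n) (Fin n) ℂ) (Z : Matrix (Fin m) (Fin n) ℂ)
    (x : Fin m → Fin n → ℝ) :
    cexp ((π : ℂ) * I * (mc (Matrix.of x) * Ω * (mc (Matrix.of x))ᵀ
        + (2 : ℂ) • (mc (Matrix.of x) * Zᵀ)).trace)
      = ∏ i, cexp (-π * ((fun j => (x i j : ℂ)) ⬝ᵥ ((-I) • Ω) *ᵥ fun j => (x i j : ℂ))
        + 2 * π * I * ((fun j => (x i j : ℂ)) ⬝ᵥ Z i)) := by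
  rw [← Complex.exp_sum, trace, Finset.mul_sum]
  congr 1
  refine Finset.sum_congr rfl fun i _ => ?_
  have h1 : (mc (Matrix.of x) * Ω * (mc (Matrix.of x))ᵀ) i i
      = (fun j => (x i j : ℂ)) ⬝ᵥ Ω *ᵥ fun j => (x i j : ℂ) := by
    rw [Matrix.mul_assoc]
    rfl
  have h2 : (mc (Matrix.of x) * Zᵀ) i i = (fun j => (x i j : ℂ)) ⬝ᵥ Z i := rfl
  rw [diag_apply, Matrix.add_apply, Matrix.smul_apply, h1, h2, smul_mulVec, dotProduct_smul,
    smul_eq_mul, smul_eq_mul]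
  ring

lemma trace_mul_mul_transpose {n m : ℕ} (M : Matrix (Fin n) (Fin n) ℂ)
    (Z : Matrix (Fin m) (Fin n) ℂ) :
    (Z * M * Zᵀ).trace = ∑ i, Z i ⬝ᵥ M *ᵥ Z i := by
  rw [Matrix.mul_assoc]
  rfl

/-- The Gaussian matrix integral
`∫_{ℝ^{m×n}} exp(πi tr(xΩᵗx + 2xᵗZ)) dx = det(Ω/i)^{-m/2} exp(-πi tr(ZΩ⁻¹ᵗZ))`,
where `sqD` is the branch of `det^{1/2}` on symmetric matrices with positive definite
real part which is positive on real positive definite matrices. -/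
theorem gaussian_integral_matrix {n m : ℕ}
    (sqD : Matrix (Fin n) (Fin n) ℂ → ℂ)
    (hcont : ContinuousOn sqD {S | InS S})
    (hsq : ∀ S, InS S → (sqD S) ^ 2 = S.det)
    (hposval : ∀ S : Matrix (Fin n) (Fin n) ℝ, S.PosDef → sqD (mc S) = Real.sqrt S.det)
    (Ω : Matrix (Fin n) (Fin n) ℂ) (hΩ : InSiegel Ω)
    (Z : Matrix (Fin m) (Fin n) ℂ) :
    Integrable (fun x : Fin m → Fin n → ℝ =>
      Complex.exp ((Real.pi : ℂ) * Complex.I *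
        (mc (Matrix.of x) * Ω * (mc (Matrix.of x))ᵀ
          + (2 : ℂ) • (mc (Matrix.of x) * Zᵀ)).trace)) ∧
    (∫ x : Fin m → Fin n → ℝ,
        Complex.exp ((Real.pi : ℂ) * Complex.I *
          (mc (Matrix.of x) * Ω * (mc (Matrix.of x))ᵀ
            + (2 : ℂ) • (mc (Matrix.of x) * Zᵀ)).trace))
      = (sqD ((-Complex.I) • Ω)) ^ (-(m : ℤ)) *
        Complex.exp (-(Real.pi : ℂ) * Complex.I * (Z * Ω⁻¹ * Zᵀ).trace) := by
  obtain ⟨Q, d, hQ, hA, hS⟩ := hΩ.exists_diagonalization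
  have hb : ∀ j, 0 < (1 + I * (d j : ℂ)).re := fun j => by simp
  have hrow := fun i => integral_cexp_quadratic_form hQ (fun j => 1 + I * (d j : ℂ)) (Z i) hb
  rw [← sqrt_det_branch_eq sqD hcont hsq hposval Q d hQ hA, ← hS] at hrow
  simp only [exp_trace_eq_prod]
  refine ⟨Integrable.fintype_prod fun i => (hrow i).1, ?_⟩
  rw [integral_fintype_prod_volume_eq_prod (fun i (v : Fin n → ℝ) =>
      cexp (-π * ((fun j => (v j : ℂ)) ⬝ᵥ ((-I) • Ω) *ᵥ fun j => (v j : ℂ))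
        + 2 * π * I * ((fun j => (v j : ℂ)) ⬝ᵥ Z i))),
    Finset.prod_congr rfl fun i _ => (hrow i).2, Finset.prod_mul_distrib, Finset.prod_const,
    Finset.card_univ, Fintype.card_fin, inv_pow, _root_.zpow_neg, zpow_natCast, ← Complex.exp_sum,
    trace_mul_mul_transpose, Finset.mul_sum]
  congr 2
  refine Finset.sum_congr rfl fun i _ => ?_
  have hinv : ((-I) • Ω)⁻¹ = I • Ω⁻¹ := by
    by_cases hdet : IsUnit Ω.det
    · refine inv_eq_right_inv ?_
      rw [Matrix.smul_mul, Matrix.mul_smul, smul_smul, mul_nonsing_inv _ hdet]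
      simp
    · have hdet' : ¬IsUnit ((-I) • Ω).det := by
        simp only [isUnit_iff_ne_zero, not_not] at hdet ⊢
        rw [det_smul, hdet, mul_zero]
      rw [nonsing_inv_apply_not_isUnit _ hdet, nonsing_inv_apply_not_isUnit _ hdet', smul_zero]
  rw [hinv, smul_mulVec, dotProduct_smul, smul_eq_mul]
  ring
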